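/- Let H be a connected graph containing at least one edge, let v be a vertex of H, and let k ≥ 3. Let G_1 be the graph obtained by identifying v with a vertex of the cycle C_k, and let G_2 be the graph obtained by identifying v with a vertex of minimum degree of the lollipop L_{k,3} (for k ≥ 4 this is the pendant end-vertex of its path). Then W(G_1) ≤ W(G_2), with equality if and only if k = 3. -/

import Mathlib

open SimpleGraph Finset
open scoped Classical

noncomputable section

/-- The Wiener index of a graph, as a rational number: half of the sum of
distances over all ordered pairs of vertices (i.e. the sum over unordered pairs). -/
def wienerIndex {V : Type*} [Fintype V] (G : SimpleGraph V) : ℚ :=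
  (∑ u : V, ∑ v : V, (G.dist u v : ℚ)) / 2

/-- The transmission `D_G(v)` of a vertex: the sum of distances to all vertices. -/
def transmission {V : Type*} [Fintype V] (G : SimpleGraph V) (v : V) : ℚ :=
  ∑ x : V, (G.dist x v : ℚ)

/-- `n_u(e)` for `e = uv`: the number of vertices strictly closer to `u` than to `v`. -/
def nCloser {V : Type*} [Fintype V] (G : SimpleGraph V) (u v : V) : ℕ :=
  (Finset.univ.filter fun w => G.dist u w < G.dist v w).card

/-- `n_0(e)` for `e = uv`: the number of vertices equidistant from `u` and `v`. -/
def nEqual {V : Type*} [Fintype V] (G : SimpleGraph V) (u v : V) : ℕ :=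
  (Finset.univ.filter fun w => G.dist u w = G.dist v w).card

/-- The Szeged index, as a rational number (each edge is counted once). -/
def szeged {V : Type*} [Fintype V] (G : SimpleGraph V) : ℚ :=
  (∑ u : V, ∑ v : V,
    if G.Adj u v then (nCloser G u v : ℚ) * (nCloser G v u : ℚ) else 0) / 2

/-- The revised Szeged index, as a rational number (each edge is counted once). -/
def szegedStar {V : Type*} [Fintype V] (G : SimpleGraph V) : ℚ :=
  (∑ u : V, ∑ v : V,
    if G.Adj u v then
      ((nCloser G u v : ℚ) + (nEqual G u v : ℚ) / 2) *
        ((nCloser G v u : ℚ) + (nEqual G u v : ℚ) / 2)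
    else 0) / 2

/-- The cycle `C_k` on the vertices `0, 1, …, k-1`. -/
def cycleG (k : ℕ) : SimpleGraph (Fin k) :=
  SimpleGraph.fromRel (fun a b => a.val + 1 = b.val ∨ (a.val = 0 ∧ b.val = k - 1))

/-- The lollipop `L_{n,r}`: the cycle `C_r` on `0, …, r-1` together with the
path `r-1, r, …, n-1` attached at the cycle vertex `r-1`. -/
def lollipop (n r : ℕ) : SimpleGraph (Fin n) :=
  SimpleGraph.fromRel (fun a b => a.val + 1 = b.val ∨ (a.val = 0 ∧ b.val = r - 1))

/-- `H_n^0`: a triangle `0,1,2`, a path `2, 3, …, n-3` (so `u_1 = 2`, `u_{n-4} = n-3`)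
and two pendant vertices `n-2, n-1` attached at `n-3`. -/
def Hgraph0 (n : ℕ) : SimpleGraph (Fin n) :=
  SimpleGraph.fromRel (fun a b =>
    (a.val + 1 = b.val ∧ b.val ≤ n - 2) ∨ (a.val = 0 ∧ b.val = 2) ∨
    (a.val = n - 3 ∧ b.val = n - 1))

/-- `H_n^1`: a triangle `0,1,2`, a path `2, 3, …, n-4` (so `u_1 = 2`, `u_{n-5} = n-4`),
a path of length two `n-4, n-3, n-2` and a pendant vertex `n-1` attached at `n-4`. -/
def Hgraph1 (n : ℕ) : SimpleGraph (Fin n) :=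
  SimpleGraph.fromRel (fun a b =>
    (a.val + 1 = b.val ∧ b.val ≤ n - 2) ∨ (a.val = 0 ∧ b.val = 2) ∨
    (a.val = n - 4 ∧ b.val = n - 1))

/-- `H_n^2`: a `4`-cycle `0,1,2,3`, a path `3, 4, …, n-3` (so `u_1 = 3`, `u_{n-5} = n-3`)
and two pendant vertices `n-2, n-1` attached at `n-3`. -/
def Hgraph2 (n : ℕ) : SimpleGraph (Fin n) :=
  SimpleGraph.fromRel (fun a b =>
    (a.val + 1 = b.val ∧ b.val ≤ n - 2) ∨ (a.val = 0 ∧ b.val = 3) ∨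
    (a.val = n - 3 ∧ b.val = n - 1))

/-- `H_n^3`: a triangle `0,1,2`, a path `2, 3, …, n-4` (so `u_1 = 2`, `u_{n-5} = n-4`),
two pendant vertices `n-3, n-2` attached at `n-4`, and a pendant vertex `n-1`
attached at the second triangle vertex `0`. -/
def Hgraph3 (n : ℕ) : SimpleGraph (Fin n) :=
  SimpleGraph.fromRel (fun a b =>
    (a.val + 1 = b.val ∧ b.val ≤ n - 3) ∨ (a.val = 0 ∧ b.val = 2) ∨
    (a.val = n - 4 ∧ b.val = n - 2) ∨ (a.val = 0 ∧ b.val = n - 1))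

/-- `B(n,s)`: `K_4^-` on the vertices `x = n-s-4`, `u = n-s-3`, `y = n-s-2`, `v = n-1`
(with the edge `xy` missing), a path on `n-s-4` vertices `0, …, n-s-5` attached at `x`,
and a path on `s` vertices `n-s-1, …, n-2` attached at `y`. -/
def Bgraph (n s : ℕ) : SimpleGraph (Fin n) :=
  SimpleGraph.fromRel (fun a b =>
    (a.val + 1 = b.val ∧ b.val ≤ n - 2) ∨
    (b.val = n - 1 ∧ (a.val = n - s - 4 ∨ a.val = n - s - 3 ∨ a.val = n - s - 2)))

/-- `B_n^{(1)}`: `K_4^-` on the vertices `n-4, n-3, n-2, n-1` (with the edge between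
`n-2` and `n-1` missing), with an end-vertex of the path `0, 1, …, n-4` identified with
the degree-`3` vertex `n-4` of `K_4^-`. -/
def Bn1 (n : ℕ) : SimpleGraph (Fin n) :=
  SimpleGraph.fromRel (fun a b =>
    (a.val + 1 = b.val ∧ b.val ≤ n - 3) ∨
    (a.val = n - 4 ∧ b.val = n - 2) ∨ (a.val = n - 4 ∧ b.val = n - 1) ∨
    (a.val = n - 3 ∧ b.val = n - 2) ∨ (a.val = n - 3 ∧ b.val = n - 1))

/-- `B_n^{3,3}`: two triangles `0,1,2` and `n-3,n-2,n-1` joined by the path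
`2, 3, …, n-3` of length `n-5`. -/
def B33 (n : ℕ) : SimpleGraph (Fin n) :=
  SimpleGraph.fromRel (fun a b =>
    a.val + 1 = b.val ∨ (a.val = 0 ∧ b.val = 2) ∨ (a.val = n - 3 ∧ b.val = n - 1))

/-- `C_r(P_{m 0 + 1}, …, P_{m (r-1) + 1})`: the unicyclic graph obtained from the cycle
`C_r` by identifying, for each `i`, one end-vertex of a path on `m i + 1` vertices with
the `i`-th cycle vertex.  The vertex `⟨i, 0⟩` is the cycle vertex `v_i`, and `⟨i, j⟩`
for `j ≥ 1` are the remaining vertices of the path attached at `v_i`. -/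
def cyclePaths (r : ℕ) (m : Fin r → ℕ) : SimpleGraph (Σ i : Fin r, Fin (m i + 1)) :=
  SimpleGraph.fromRel (fun a b =>
    (a.2.val = 0 ∧ b.2.val = 0 ∧ (a.1.val + 1) % r = b.1.val) ∨
    (a.1 = b.1 ∧ a.2.val + 1 = b.2.val))

/-- The graph obtained from vertex-disjoint graphs `G₁`, `G₂` by identifying the
vertex `v₁` of `G₁` with the vertex `v₂` of `G₂`; the common vertex is `Sum.inl v₁`. -/
def glue {V₁ V₂ : Type*} (G₁ : SimpleGraph V₁) (G₂ : SimpleGraph V₂) (v₁ : V₁) (v₂ : V₂) :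
    SimpleGraph (V₁ ⊕ {x : V₂ // x ≠ v₂}) :=
  SimpleGraph.fromRel (fun a b =>
    match a, b with
    | Sum.inl a, Sum.inl b => G₁.Adj a b
    | Sum.inr a, Sum.inr b => G₂.Adj a.val b.val
    | Sum.inl a, Sum.inr b => a = v₁ ∧ G₂.Adj v₂ b.val
    | Sum.inr _, Sum.inl _ => False)

/-- The spider `A_{n,4}`: a center `n-5` with one leg `n-5, n-6, …, 0` of length
`n-5` and four legs of length one ending at the unit leaves `n-4, n-3, n-2, n-1`;
the non-unit leaf is the vertex `0`. -/
def spiderA (n : ℕ) : SimpleGraph (Fin n) :=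
  SimpleGraph.fromRel (fun a b =>
    (a.val + 1 = b.val ∧ b.val ≤ n - 5) ∨ (a.val = n - 5 ∧ n - 4 ≤ b.val))

/-- The theta graph `B_{k,l,t}` on `k + l + t - 1` vertices: the vertices `u = 0` and
`w = k` joined by three internally disjoint paths of lengths `k`, `l`, `t`, with
internal vertices `1, …, k-1`, `k+1, …, k+l-1` and `k+l, …, k+l+t-2` respectively. -/
def theta (k l t : ℕ) : SimpleGraph (Fin (k + l + t - 1)) :=
  SimpleGraph.fromRel (fun a b =>
    (a.val + 1 = b.val ∧ b.val ≤ k) ∨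
    (a.val = 0 ∧ b.val = k + 1) ∨
    (a.val + 1 = b.val ∧ k + 1 ≤ a.val ∧ b.val ≤ k + l - 1) ∨
    (a.val = k ∧ b.val = k + l - 1) ∨
    (a.val = 0 ∧ b.val = k + l) ∨
    (a.val + 1 = b.val ∧ k + l ≤ a.val ∧ b.val ≤ k + l + t - 2) ∨
    (a.val = k ∧ b.val = k + l + t - 2))

/-- A set of vertices `B` induces a subgraph with no cut vertex. -/
def NoCutVtx {V : Type*} (G : SimpleGraph V) (B : Set V) : Prop :=
  ∀ v ∈ B, (G.induce (B \ {v})).Preconnected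

/-- `B` is (the vertex set of) a block of `G`: a maximal connected subgraph of `G`
without a cut vertex. -/
def IsBlock {V : Type*} (G : SimpleGraph V) (B : Set V) : Prop :=
  (G.induce B).Connected ∧ NoCutVtx G B ∧
  ∀ C : Set V, B ⊆ C → (G.induce C).Connected → NoCutVtx G C → C = B

section Distance

variable {V W : Type*}

lemma dist_hom_le {G : SimpleGraph V} {G' : SimpleGraph W} (hG : G.Connected)
    (f : G →g G') (a b : V) : G'.dist (f a) (f b) ≤ G.dist a b := by
  obtain ⟨p, hp⟩ := hG.exists_walk_length_eq_dist a b
  rw [← hp, ← Walk.length_map f p]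
  exact dist_le _

/-- A vertex function that grows by at most one along each edge grows by at most the distance. -/
lemma le_add_dist_of_adj {G : SimpleGraph V} (hG : G.Connected) (f : V → ℕ)
    (hf : ∀ a b, G.Adj a b → f b ≤ f a + 1) (a b : V) : f b ≤ f a + G.dist a b := by
  obtain ⟨p, hp⟩ := hG.exists_walk_length_eq_dist a b
  rw [← hp]
  clear hp
  induction p with
  | nil => simp
  | cons h p ih =>
    have := hf _ _ h
    rw [Walk.length_cons]
    omega

lemma dist_le_dist_add_one {G : SimpleGraph V} (hG : G.Connected) (a : V) {b c : V}
    (h : G.Adj b c) : G.dist a c ≤ G.dist a b + 1 := by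
  have := hG.dist_triangle (u := a) (v := b) (w := c)
  rwa [dist_eq_one_iff_adj.2 h] at this

end Distance

section Glue

variable {V W : Type*} {G : SimpleGraph V} {K : SimpleGraph W} {v : V} {w : W}

lemma glue_adj_inl_inl {a b : V} : (glue G K v w).Adj (.inl a) (.inl b) ↔ G.Adj a b := by
  simp only [glue, fromRel_adj, ne_eq, Sum.inl.injEq]
  exact ⟨fun h => h.2.elim id fun h => h.symm, fun h => ⟨h.ne, .inl h⟩⟩

lemma glue_adj_inr_inr {x y : {x : W // x ≠ w}} :
    (glue G K v w).Adj (.inr x) (.inr y) ↔ K.Adj x y := by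
  simp only [glue, fromRel_adj, ne_eq, Sum.inr.injEq]
  exact ⟨fun h => h.2.elim id fun h => h.symm,
    fun h => ⟨fun e => h.ne (congrArg Subtype.val e), .inl h⟩⟩

lemma glue_adj_inl_inr {a : V} {x : {x : W // x ≠ w}} :
    (glue G K v w).Adj (.inl a) (.inr x) ↔ a = v ∧ K.Adj w x := by
  simp [glue, fromRel_adj]

/-- The inclusion of the first graph into the glued graph. -/
def glueInl (G : SimpleGraph V) (K : SimpleGraph W) (v : V) (w : W) : G →g glue G K v w where
  toFun := Sum.inl
  map_rel' h := glue_adj_inl_inl.2 h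

/-- The inclusion of the second graph into the glued graph. -/
def glueInr (G : SimpleGraph V) (K : SimpleGraph W) (v : V) (w : W) : K →g glue G K v w where
  toFun x := if h : x = w then .inl v else .inr ⟨x, h⟩
  map_rel' {x y} h := by
    by_cases hx : x = w <;> by_cases hy : y = w
    · exact absurd (hx.trans hy.symm) h.ne
    · subst hx
      simpa [hy, glue_adj_inl_inr] using h
    · subst hy
      simpa [hx, adj_comm, glue_adj_inl_inr] using h.symm
    · simpa [hx, hy, glue_adj_inr_inr] using h

lemma glueInr_root : glueInr G K v w w = .inl v := by simp [glueInr]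

lemma glueInr_of_ne (x : {x : W // x ≠ w}) : glueInr G K v w x = .inr x := by
  simp [glueInr, x.2]

lemma glue_connected (hG : G.Connected) (hK : K.Connected) : (glue G K v w).Connected := by
  have key : ∀ z, (glue G K v w).Reachable (.inl v) z := by
    rintro (a | x)
    · exact (hG.preconnected v a).map (glueInl G K v w)
    · have := (hK.preconnected w x).map (glueInr G K v w)
      rwa [glueInr_root, glueInr_of_ne] at this
  have : Nonempty (V ⊕ {x : W // x ≠ w}) := ⟨.inl v⟩
  exact ⟨fun a b => (key a).symm.trans (key b)⟩

/-- Lower bounds for distances in a glued graph from a function on each part. -/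
lemma glue_le_add_dist (hG : G.Connected) (hK : K.Connected) (f : V → ℕ) (g : W → ℕ)
    (hf : ∀ a b, G.Adj a b → f b ≤ f a + 1) (hg : ∀ x y, K.Adj x y → g y ≤ g x + 1)
    (hfg : f v = g w) (p q : V ⊕ {x : W // x ≠ w}) :
    Sum.elim f (fun x : {x : W // x ≠ w} => g x) q ≤
      Sum.elim f (fun x : {x : W // x ≠ w} => g x) p + (glue G K v w).dist p q := by
  refine le_add_dist_of_adj (glue_connected hG hK) _ ?_ p q
  rintro (a | x) (b | y) h
  · exact hf _ _ (glue_adj_inl_inl.1 h)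
  · obtain ⟨rfl, hK⟩ := glue_adj_inl_inr.1 h
    simpa [hfg] using hg _ _ hK
  · obtain ⟨rfl, hK⟩ := glue_adj_inl_inr.1 h.symm
    simpa [hfg] using hg _ _ hK.symm
  · exact hg _ _ (glue_adj_inr_inr.1 h)

lemma glue_dist_inl_inl (hG : G.Connected) (hK : K.Connected) (a b : V) :
    (glue G K v w).dist (.inl a) (.inl b) = G.dist a b := by
  refine le_antisymm (dist_hom_le hG (glueInl G K v w) a b) ?_
  simpa using glue_le_add_dist (v := v) (w := w) hG hK (G.dist a)
    (fun x => G.dist a v + K.dist w x) (fun _ _ h => dist_le_dist_add_one hG a h)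
    (fun _ _ h => by have := dist_le_dist_add_one hK w h; omega) (by simp) (.inl a) (.inl b)

lemma glue_dist_inr_inr (hG : G.Connected) (hK : K.Connected) (x y : {x : W // x ≠ w}) :
    (glue G K v w).dist (.inr x) (.inr y) = K.dist x y := by
  refine le_antisymm ?_ ?_
  · simpa only [glueInr_of_ne] using dist_hom_le hK (glueInr G K v w) x y
  · simpa using glue_le_add_dist (v := v) (w := w) hG hK
      (fun b => K.dist x w + G.dist v b) (K.dist x)
      (fun _ _ h => by have := dist_le_dist_add_one hG v h; omega)
      (fun _ _ h => dist_le_dist_add_one hK x h) (by simp) (.inr x) (.inr y)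

lemma glue_dist_inl_inr (hG : G.Connected) (hK : K.Connected) (a : V) (x : {x : W // x ≠ w}) :
    (glue G K v w).dist (.inl a) (.inr x) = G.dist a v + K.dist w x := by
  refine le_antisymm ?_ ?_
  · refine ((glue_connected hG hK).dist_triangle (v := .inl v)).trans ?_
    have := dist_hom_le hK (glueInr G K v w) w x
    rw [glueInr_root, glueInr_of_ne] at this
    rw [glue_dist_inl_inl hG hK]
    omega
  · simpa using glue_le_add_dist (v := v) (w := w) hG hK (G.dist a)
      (fun x => G.dist a v + K.dist w x) (fun _ _ h => dist_le_dist_add_one hG a h)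
      (fun _ _ h => by have := dist_le_dist_add_one hK w h; omega) (by simp) (.inl a) (.inr x)

/-- The Wiener index of two connected graphs glued at a vertex. -/
lemma wienerIndex_glue [Fintype V] [Fintype W] [Fintype {x : W // x ≠ w}]
    (hG : G.Connected) (hK : K.Connected) :
    wienerIndex (glue G K v w) = wienerIndex G + wienerIndex K
      + (Fintype.card W - 1) * transmission G v + (Fintype.card V - 1) * transmission K w := by
  have sub (f : W → ℚ) : ∑ x : {x : W // x ≠ w}, f x = ∑ x, f x - f w := by
    rw [Fintype.sum_eq_add_sum_subtype_ne f w, add_sub_cancel_left]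
    congr!
  have hinr (x : {x : W // x ≠ w}) (a : V) : (glue G K v w).dist (.inr x) (.inl a) =
      K.dist x w + G.dist a v := by
    rw [SimpleGraph.dist_comm, glue_dist_inl_inr hG hK, add_comm, K.dist_comm]
  have hcol : ∑ x : {x : W // x ≠ w}, (K.dist x w : ℚ) = transmission K w := by
    simp [sub fun x => (K.dist x w : ℚ), transmission]
  have hrow : ∑ x : {x : W // x ≠ w}, (K.dist w x : ℚ) = transmission K w := by
    simpa only [K.dist_comm] using hcol
  have hsq : ∑ x : {x : W // x ≠ w}, ∑ y : {x : W // x ≠ w}, (K.dist x y : ℚ) =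
      ∑ x, ∑ y, (K.dist x y : ℚ) - 2 * transmission K w := by
    have hx (x : W) := sub fun y => (K.dist x y : ℚ)
    simp only [hx, sum_sub_distrib, hcol]
    rw [sub fun x => ∑ y, (K.dist x y : ℚ)]
    have : ∑ y, (K.dist w y : ℚ) = transmission K w := by
      simp only [transmission, K.dist_comm]
    rw [this]
    ring
  have hcard : (Fintype.card {x : W // x ≠ w} : ℚ) = Fintype.card W - 1 := by
    simpa using sub fun _ => 1
  have htr : ∑ a, (G.dist a v : ℚ) = transmission G v := rfl
  simp only [wienerIndex, Fintype.sum_sum_type, glue_dist_inl_inl hG hK, hinr,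
    glue_dist_inr_inr hG hK, glue_dist_inl_inr hG hK, Nat.cast_add, sum_add_distrib,
    sum_const, card_univ, nsmul_eq_mul, ← mul_sum, hcol, hrow, hsq, hcard, htr]
  ring

end Glue

section PathLike

variable {k : ℕ} {G : SimpleGraph (Fin k)}

lemma exists_walk_of_succ_adj (hG : ∀ a b : Fin k, a.val + 1 = b.val → G.Adj a b) (d : ℕ)
    (a b : Fin k) (h : a.val + d = b.val) : ∃ p : G.Walk a b, p.length = d := by
  induction d generalizing a with
  | zero =>
    obtain rfl : a = b := Fin.ext (by omega)
    exact ⟨.nil, rfl⟩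
  | succ d ih =>
    obtain ⟨p, hp⟩ := ih ⟨a.val + 1, by omega⟩ (by simp only; omega)
    exact ⟨.cons (hG a _ rfl) p, by simp [hp]⟩

lemma connected_of_succ_adj (hk : 0 < k) (hG : ∀ a b : Fin k, a.val + 1 = b.val → G.Adj a b) :
    G.Connected := by
  have : Nonempty (Fin k) := ⟨⟨0, hk⟩⟩
  have key (a : Fin k) : G.Reachable ⟨0, hk⟩ a :=
    ⟨(exists_walk_of_succ_adj hG a.val ⟨0, hk⟩ a (by simp)).choose⟩
  exact ⟨fun a b => (key a).symm.trans (key b)⟩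

lemma cycleG_adj_of_succ (a b : Fin k) (h : a.val + 1 = b.val) : (cycleG k).Adj a b := by
  rw [cycleG, fromRel_adj]
  exact ⟨fun e => by subst e; omega, .inl (.inl h)⟩

lemma lollipop_adj_of_succ (r : ℕ) (a b : Fin k) (h : a.val + 1 = b.val) :
    (lollipop k r).Adj a b := by
  rw [lollipop, fromRel_adj]
  exact ⟨fun e => by subst e; omega, .inl (.inl h)⟩

lemma cycleG_connected (hk : 0 < k) : (cycleG k).Connected :=
  connected_of_succ_adj hk cycleG_adj_of_succ

lemma lollipop_connected (hk : 0 < k) (r : ℕ) : (lollipop k r).Connected :=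
  connected_of_succ_adj hk (lollipop_adj_of_succ r)

end PathLike

section Cycle

lemma cycleG_dist_le_of_le {k : ℕ} (hk : 2 ≤ k) {a b : Fin k} (h : a ≤ b) :
    (cycleG k).dist a b ≤ min (b.val - a.val) (k - (b.val - a.val)) := by
  have hab : a.val ≤ b.val := h
  refine le_min ?_ ?_
  · obtain ⟨p, hp⟩ := exists_walk_of_succ_adj cycleG_adj_of_succ (b.val - a.val) a b (by omega)
    exact hp ▸ dist_le p
  · obtain ⟨p, hp⟩ := exists_walk_of_succ_adj cycleG_adj_of_succ a.val ⟨0, by omega⟩ a (by simp)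
    obtain ⟨q, hq⟩ := exists_walk_of_succ_adj cycleG_adj_of_succ (k - 1 - b.val) b
      ⟨k - 1, by omega⟩ (by simp only; omega)
    have e : (cycleG k).Adj ⟨0, by omega⟩ ⟨k - 1, by omega⟩ := by
      rw [cycleG, fromRel_adj]
      exact ⟨fun e => by rw [Fin.mk.injEq] at e; omega, .inl (.inr ⟨rfl, rfl⟩)⟩
    have := dist_le (p.reverse.append (.cons e q.reverse))
    simp only [Walk.length_append, Walk.length_cons, Walk.length_reverse, hp, hq] at this
    omega

lemma cycleG_dist_le {k : ℕ} (hk : 2 ≤ k) (a b : Fin k) :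
    (cycleG k).dist a b ≤ min (a - b).val (k - (a - b).val) := by
  rcases le_total b a with h | h
  · rw [SimpleGraph.dist_comm, Fin.sub_val_of_le h]
    exact cycleG_dist_le_of_le hk h
  · refine (cycleG_dist_le_of_le hk h).trans ?_
    have hab : a.val ≤ b.val := h
    rcases h.eq_or_lt with rfl | h
    · simp
    · have hlt : a.val < b.val := h
      rw [Fin.sub_def]
      simp only
      rw [Nat.mod_eq_of_lt (by omega)]
      omega

lemma four_mul_sum_min_le (k : ℕ) : 4 * ∑ i ∈ range k, min i (k - i) ≤ k ^ 2 := by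
  induction k using Nat.twoStepInduction with
  | zero => simp
  | one => simp
  | more k ih _ =>
    have h : ∀ i ∈ range k, min (i + 1) (k + 2 - (i + 1)) = min i (k - i) + 1 := by
      intro i hi
      rw [Finset.mem_range] at hi
      omega
    rw [sum_range_succ, sum_range_succ', sum_congr rfl h, sum_add_distrib]
    simp only [sum_const, card_range, smul_eq_mul]
    have : min (k + 1) (k + 2 - (k + 1)) = 1 := by omega
    rw [this]
    simp only [zero_le, inf_of_le_left]
    nlinarith

lemma transmission_cycleG_le {k : ℕ} (hk : 2 ≤ k) (a : Fin k) :
    transmission (cycleG k) a ≤ k ^ 2 / 4 := by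
  have : NeZero k := ⟨by omega⟩
  have h : ∑ x, (cycleG k).dist x a ≤ ∑ i ∈ range k, min i (k - i) := by
    refine (sum_le_sum fun x _ => cycleG_dist_le hk x a).trans_eq ?_
    rw [← Fin.sum_univ_eq_sum_range (fun i => min i (k - i))]
    exact (Equiv.subRight a).sum_comp fun i : Fin k => min i.val (k - i.val)
  have h' : (4 * ∑ x, (cycleG k).dist x a : ℚ) ≤ k ^ 2 := by
    exact_mod_cast (Nat.mul_le_mul_left 4 h).trans (four_mul_sum_min_le k)
  push_cast at h'
  rw [transmission]
  linarith

lemma wienerIndex_cycleG_le {k : ℕ} (hk : 2 ≤ k) : wienerIndex (cycleG k) ≤ k ^ 3 / 8 := by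
  have h := sum_le_sum fun (a : Fin k) (_ : a ∈ univ) => transmission_cycleG_le hk a
  simp only [transmission, sum_const, card_univ, Fintype.card_fin, nsmul_eq_mul] at h
  rw [wienerIndex, sum_comm]
  linarith

end Cycle

section Lollipop

/-- Collapsing the two vertices of degree two of the triangle bounds distances from below. -/
lemma lollipop_le_dist {n : ℕ} (a b : Fin n) :
    max b.val 1 ≤ max a.val 1 + (lollipop n 3).dist a b := by
  refine le_add_dist_of_adj (lollipop_connected (by have := a.2; omega) 3)
    (fun x : Fin n => max x.val 1) (fun x y h => ?_) a b
  rw [lollipop, fromRel_adj] at h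
  omega

lemma le_lollipop_dist_succ_succ {n : ℕ} (i j : Fin n) :
    |(i : ℚ) - j| ≤ (lollipop (n + 1) 3).dist i.succ j.succ := by
  have h₁ := lollipop_le_dist i.succ j.succ
  have h₂ := lollipop_le_dist j.succ i.succ
  rw [SimpleGraph.dist_comm] at h₂
  simp only [Fin.val_succ] at h₁ h₂
  have h₁' : j.val ≤ i.val + (lollipop (n + 1) 3).dist i.succ j.succ := by omega
  have h₂' : i.val ≤ j.val + (lollipop (n + 1) 3).dist i.succ j.succ := by omega
  qify at h₁' h₂'
  rw [abs_le]
  constructor <;> linarith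

lemma le_lollipop_dist_zero_succ {n : ℕ} (j : Fin n) :
    (j : ℚ) + (if j.val = 0 then 1 else 0) ≤ (lollipop (n + 1) 3).dist 0 j.succ := by
  split_ifs with h
  · have := (lollipop_connected (Nat.add_pos_right n one_pos) 3).pos_dist_of_ne (Fin.succ_ne_zero j).symm
    rw [h]
    exact_mod_cast (by omega : 0 + 1 ≤ (lollipop (n + 1) 3).dist 0 j.succ)
  · have := lollipop_le_dist 0 j.succ
    simp only [Fin.val_succ, Fin.val_zero] at this
    exact_mod_cast (by omega : j.val + 0 ≤ (lollipop (n + 1) 3).dist 0 j.succ)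

lemma sum_range_cast (n : ℕ) : ∑ i ∈ range n, (i : ℚ) = n * (n - 1) / 2 := by
  induction n with
  | zero => simp
  | succ n ih => rw [sum_range_succ, ih]; push_cast; ring

lemma sum_range_abs_sub (n : ℕ) : ∑ i ∈ range n, |(i : ℚ) - n| = n * (n + 1) / 2 := by
  have : ∀ i ∈ range n, |(i : ℚ) - n| = n - i := fun i hi => by
    have : (i : ℚ) ≤ n := by exact_mod_cast (Finset.mem_range.1 hi).le
    rw [abs_of_nonpos (by linarith)]
    ring
  rw [sum_congr rfl this, sum_sub_distrib, sum_range_cast]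
  simp only [sum_const, card_range, nsmul_eq_mul]
  ring

lemma sum_range_sum_range_abs_sub (n : ℕ) :
    ∑ i ∈ range n, ∑ j ∈ range n, |(i : ℚ) - j| = (n ^ 3 - n) / 3 := by
  induction n with
  | zero => simp
  | succ n ih =>
    have h := sum_range_abs_sub n
    have h' : ∑ j ∈ range n, |(n : ℚ) - j| = n * (n + 1) / 2 := by
      simpa only [abs_sub_comm] using h
    simp only [sum_range_succ, sum_add_distrib, ih, h, h', sub_self, abs_zero]
    push_cast
    ring

lemma le_wienerIndex_lollipop {n : ℕ} (hn : 0 < n) :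
    ((n : ℚ) ^ 3 - n) / 6 + n * (n - 1) / 2 + 1 ≤ wienerIndex (lollipop (n + 1) 3) := by
  have hpath := sum_le_sum fun (i : Fin n) (_ : i ∈ univ) =>
    sum_le_sum fun (j : Fin n) (_ : j ∈ univ) => le_lollipop_dist_succ_succ i j
  have hzero := sum_le_sum fun (j : Fin n) (_ : j ∈ univ) => le_lollipop_dist_zero_succ j
  have hpath_eq : ∑ i : Fin n, ∑ j : Fin n, |(i : ℚ) - j| = (n ^ 3 - n) / 3 := by
    rw [← sum_range_sum_range_abs_sub, ← Fin.sum_univ_eq_sum_range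
      (fun i => ∑ j ∈ range n, |(i : ℚ) - j|)]
    exact sum_congr rfl fun i _ => Fin.sum_univ_eq_sum_range (fun j => |(i : ℚ) - j|) n
  have hzero_eq : ∑ j : Fin n, ((j : ℚ) + (if j.val = 0 then 1 else 0)) =
      n * (n - 1) / 2 + 1 := by
    rw [Fin.sum_univ_eq_sum_range (fun j => (j : ℚ) + (if j = 0 then 1 else 0)),
      sum_add_distrib, sum_range_cast]
    simp [hn.ne']
  rw [hpath_eq] at hpath
  rw [hzero_eq] at hzero
  have hsymm (i : Fin n) : (lollipop (n + 1) 3).dist i.succ 0 =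
      (lollipop (n + 1) 3).dist 0 i.succ := SimpleGraph.dist_comm
  simp only [wienerIndex, Fin.sum_univ_succ, sum_add_distrib, SimpleGraph.dist_self, hsymm]
  push_cast
  linarith

lemma le_transmission_lollipop {n : ℕ} (hn : 2 ≤ n) :
    (n : ℚ) * (n - 1) / 2 + (n - 1) ≤ transmission (lollipop (n + 1) 3) (Fin.last n) := by
  obtain ⟨m, rfl⟩ : ∃ m, n = m + 1 := ⟨n - 1, by omega⟩
  have hpath := sum_le_sum fun (i : Fin (m + 1)) (_ : i ∈ univ) =>
    le_lollipop_dist_succ_succ i (Fin.last m)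
  have hzero := le_lollipop_dist_zero_succ (Fin.last m)
  have hpath_eq : ∑ i : Fin (m + 1), |(i : ℚ) - (Fin.last m : ℕ)| = m * (m + 1) / 2 := by
    rw [Fin.val_last, Fin.sum_univ_eq_sum_range (fun i => |(i : ℚ) - m|), sum_range_succ,
      sum_range_abs_sub]
    simp
  rw [hpath_eq] at hpath
  rw [Fin.val_last, if_neg (by omega)] at hzero
  rw [transmission, Fin.sum_univ_succ, ← Fin.succ_last]
  push_cast
  linarith

end Lollipop

lemma cycleG_three : cycleG 3 = ⊤ := by
  ext a b
  rw [cycleG, fromRel_adj, top_adj]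
  omega

lemma transmission_cycleG_three (a : Fin 3) : transmission (cycleG 3) a = 2 := by
  simp only [transmission, cycleG_three, dist_top]
  fin_cases a <;> simp [Fin.sum_univ_three] <;> norm_num

/-- Attaching a cycle `C_k` at a vertex `v` of `H` gives Wiener index
at most that of attaching the lollipop `L_{k,3}` at its minimum degree vertex,
with equality iff `k = 3`. -/
theorem wiener_glue_cycle_le_glue_lollipop
    {V : Type*} [Fintype V] (H : SimpleGraph V) (hH : H.Connected)
    (hedge : ∃ a b : V, H.Adj a b) (v : V) (k : ℕ) (hk : 3 ≤ k) :
    wienerIndex (glue H (cycleG k) v ⟨0, by omega⟩) ≤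
      wienerIndex (glue H (lollipop k 3) v ⟨k - 1, by omega⟩) ∧
    (wienerIndex (glue H (cycleG k) v ⟨0, by omega⟩) =
        wienerIndex (glue H (lollipop k 3) v ⟨k - 1, by omega⟩) ↔ k = 3) := by
  have hk₀ : 0 < k := by omega
  rw [wienerIndex_glue hH (cycleG_connected hk₀), wienerIndex_glue hH (lollipop_connected hk₀ 3)]
  rcases hk.eq_or_lt with rfl | hk4
  · have hw : wienerIndex (lollipop 3 3) = wienerIndex (cycleG 3) := rfl
    have ht (a : Fin 3) : transmission (lollipop 3 3) a = 2 := transmission_cycleG_three a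
    simp [hw, ht, transmission_cycleG_three]
  · obtain ⟨n, rfl⟩ : ∃ n, k = n + 1 := ⟨k - 1, by omega⟩
    have hcard : (1 : ℚ) ≤ Fintype.card V - 1 := by
      obtain ⟨a, b, hab⟩ := hedge
      have : 2 ≤ Fintype.card V := Fintype.one_lt_card_iff.2 ⟨a, b, hab.ne⟩
      have : (2 : ℚ) ≤ Fintype.card V := by exact_mod_cast this
      linarith
    have hn : (3 : ℚ) ≤ n := by exact_mod_cast (by omega : 3 ≤ n)
    have hwc := wienerIndex_cycleG_le (k := n + 1) (by omega)
    have hwl := le_wienerIndex_lollipop (n := n) (by omega)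
    have htc := transmission_cycleG_le (k := n + 1) (by omega) ⟨0, by omega⟩
    have htl : (n : ℚ) * (n - 1) / 2 + (n - 1) ≤
        transmission (lollipop (n + 1) 3) ⟨n + 1 - 1, by omega⟩ :=
      le_transmission_lollipop (by omega)
    push_cast at hwc htc
    have hw : wienerIndex (cycleG (n + 1)) ≤ wienerIndex (lollipop (n + 1) 3) := by
      nlinarith [mul_nonneg (sub_nonneg.2 hn) (sub_nonneg.2 hn),
        mul_nonneg (mul_nonneg (sub_nonneg.2 hn) (sub_nonneg.2 hn)) (sub_nonneg.2 hn)]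
    have ht : transmission (cycleG (n + 1)) ⟨0, by omega⟩ <
        transmission (lollipop (n + 1) 3) ⟨n + 1 - 1, by omega⟩ := by
      nlinarith [mul_nonneg (sub_nonneg.2 hn) (sub_nonneg.2 hn)]
    have hlt := mul_lt_mul_of_pos_left ht (zero_lt_one.trans_le hcard)
    refine ⟨by linarith, fun h => ?_, fun h => by omega⟩
    linarith
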